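/- Let m ≥ 5 be odd, let i satisfy gcd(i,m) = 1 and 1 ≤ i ≤ (m−1)/2, set e = 2^i + 1, and suppose F(x) = x^e is almost bent on GF(2^m). Let ν ∈ GF(2^m)\{0}, let f_ν(x) = Tr^m(ν·x^e), and let H_ν = {x ∈ GF(2^m) : Tr^m(ν^{−1}·x) = 0}. Then the subcode C_{D_{f_ν},H_ν} = {c_{x,y} : x ∈ GF(2^m), y ∈ H_ν} has 2^{2m−1} codewords, every codeword has Hamming weight in {0, 2^{m−2} − 2^{(m−1)/2}, 2^{m−2} − 2^{(m−3)/2}, 2^{m−2}, 2^{m−2} + 2^{(m−3)/2}, 2^{m−2} + 2^{(m−1)/2}}, and the number A_w of codewords of weight w is: A_0 = 1; A_{2^{m−2} − 2^{(m−1)/2}} = 2^{2m−5} + 2^{(m−5)/2} − 2^{(m−7)/2}·K(1) − 2^{m−4}; A_{2^{m−2} − 2^{(m−3)/2}} = 2^{2m−3} + 2^{(m−5)/2}·K(1) − 2^{(m−1)/2}; A_{2^{m−2}} = 3·2^{2m−4} + 2^{m−3} − 1; A_{2^{m−2} + 2^{(m−3)/2}} = 2^{2m−3} − 2^{(m−5)/2}·K(1)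 + 2^{(m−1)/2}; A_{2^{m−2} + 2^{(m−1)/2}} = 2^{2m−5} − 2^{(m−5)/2} + 2^{(m−7)/2}·K(1) − 2^{m−4}. In particular C_{D_{f_ν},H_ν} is a [2^{m−1}, 2m−1, 2^{m−2} − 2^{(m−1)/2}] five-weight binary linear code. -/

import Mathlib

open Finset
noncomputable section
open scoped Classical

/-- `GF n` is the finite field with `2^n` elements. -/
abbrev GF (n : ℕ) : Type := GaloisField 2 n

noncomputable instance (n : ℕ) : Fintype (GF n) := Fintype.ofFinite _

/-- The absolute trace map `GF n → 𝔽₂`. -/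
def tr {n : ℕ} (x : GF n) : ZMod 2 := Algebra.trace (ZMod 2) (GF n) x

/-- The Walsh transform of an `(m,s)`-function `F` at `(α, β)`. -/
def walshF {m s : ℕ} (F : GF m → GF s) (α : GF s) (β : GF m) : ℤ :=
  ∑ x : GF m, (-1 : ℤ) ^ (tr (α * F x) + tr (β * x)).val

/-- The support `D_{f_λ}` of the component function `f_λ = Tr(λ·F)`. -/
abbrev Dsupp {m s : ℕ} (F : GF m → GF s) (lam : GF s) : Type :=
  {d : GF m // tr (lam * F d) = 1}

/-- `n_{f_λ}`, the cardinality of the support of `f_λ`. -/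
def nSupp {m s : ℕ} (F : GF m → GF s) (lam : GF s) : ℕ := Fintype.card (Dsupp F lam)

/-- The codeword `c_{x,y} = (Tr(x·d) + Tr(y·F(d)))_{d ∈ D_{f_λ}}`. -/
def cw {m s : ℕ} (F : GF m → GF s) (lam : GF s) (x : GF m) (y : GF s) :
    Dsupp F lam → ZMod 2 :=
  fun d => tr (x * d.1) + tr (y * F d.1)

/-- Hamming weight of the codeword `c_{x,y}`. -/
def wtc {m s : ℕ} (F : GF m → GF s) (lam : GF s) (x : GF m) (y : GF s) : ℕ :=
  (univ.filter (fun d : Dsupp F lam => cw F lam x y d ≠ 0)).card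

/-- The number of codewords `c_{x,y}`, `y ∈ H_ν = {y : Tr(ν⁻¹·y) = 0}`, of the subcode
`C_{D_{f_ν},H_ν}` of Hamming weight `w` (codewords are identified with the pairs
`(x,y)`, which is legitimate by the injectivity claim). -/
def AwHs {m : ℕ} (F : GF m → GF m) (nu : GF m) (w : ℕ) : ℕ :=
  (univ.filter (fun p : GF m × GF m =>
    tr (nu⁻¹ * p.2) = 0 ∧ wtc F nu p.1 p.2 = w)).card

section Character

variable {n : ℕ}

lemma tr_add (x y : GF n) : tr (x + y) = tr x + tr y := map_add _ x y

lemma tr_zero : tr (0 : GF n) = 0 := map_zero _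

lemma tr_one (hn : Odd n) : tr (1 : GF n) = 1 := by
  have h := Algebra.trace_algebraMap (R := ZMod 2) (S := GF n) 1
  rw [map_one, GaloisField.finrank 2 hn.pos.ne', nsmul_one, ZMod.natCast_eq_one_iff_odd.mpr hn] at h
  exact h

lemma tr_pow_two_pow (i : ℕ) (x : GF n) : tr (x ^ 2 ^ i) = tr x := by
  induction i with
  | zero => simp
  | succ i ih =>
    rw [← ih, pow_succ, pow_mul]
    have h := Algebra.trace_eq_of_algEquiv
      (FiniteField.frobeniusAlgEquivOfAlgebraic (ZMod 2) (GF n)) (x ^ 2 ^ i)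
    rw [FiniteField.coe_frobeniusAlgEquivOfAlgebraic, ZMod.card] at h
    exact h

lemma exists_tr_mul_ne_zero {a : GF n} (ha : a ≠ 0) : ∃ b, tr (a * b) ≠ 0 := by
  by_contra! h
  exact ha ((traceForm_nondegenerate (ZMod 2) (GF n)).1 a fun b => h b)

lemma card_GF (hn : n ≠ 0) : Fintype.card (GF n) = 2 ^ n := by
  rw [← Nat.card_eq_fintype_card, GaloisField.card 2 n hn]

lemma pow_two_pow_self (hn : n ≠ 0) (x : GF n) : x ^ 2 ^ n = x := by
  rw [← card_GF hn, FiniteField.pow_card]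

/-- The canonical additive character of `GF n`. -/
def chi (x : GF n) : ℤ := (-1) ^ (tr x).val

lemma neg_one_pow_val_add (a b : ZMod 2) :
    (-1 : ℤ) ^ (a + b).val = (-1) ^ a.val * (-1) ^ b.val := by
  revert a b; decide

lemma chi_add (x y : GF n) : chi (x + y) = chi x * chi y := by
  rw [chi, tr_add, neg_one_pow_val_add]; rfl

lemma chi_zero : chi (0 : GF n) = 1 := by simp [chi, tr_zero]

lemma chi_of_tr_eq_zero {x : GF n} (h : tr x = 0) : chi x = 1 := by simp [chi, h]

lemma chi_of_tr_eq_one {x : GF n} (h : tr x = 1) : chi x = -1 := by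
  rw [chi, h]; decide

lemma chi_one (hn : Odd n) : chi (1 : GF n) = -1 := chi_of_tr_eq_one (tr_one hn)

lemma tr_eq_zero_or_one (x : GF n) : tr x = 0 ∨ tr x = 1 := by
  generalize tr x = a
  revert a; decide

lemma chi_pow_two_pow (i : ℕ) (x : GF n) : chi (x ^ 2 ^ i) = chi x := by
  rw [chi, tr_pow_two_pow]; rfl

lemma sum_chi_mul (hn : n ≠ 0) (a : GF n) :
    ∑ x : GF n, chi (x * a) = if a = 0 then 2 ^ n else 0 := by
  split_ifs with h
  · simp [h, chi_zero, card_GF hn]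
  · obtain ⟨b, hb⟩ := exists_tr_mul_ne_zero h
    have hb' : chi (b * a) = -1 :=
      chi_of_tr_eq_one ((tr_eq_zero_or_one _).resolve_left (by rwa [mul_comm]))
    have := Fintype.sum_equiv (Equiv.addRight b) (fun x => chi ((x + b) * a))
      (fun x => chi (x * a)) fun x => rfl
    simp only [add_mul, chi_add, hb', mul_neg, mul_one, sum_neg_distrib] at this
    linarith

lemma sum_chi (hn : n ≠ 0) : ∑ x : GF n, chi x = 0 := by
  simpa using sum_chi_mul hn 1

end Character

section Walsh

variable {m : ℕ}

lemma walshF_eq_sum_chi (F : GF m → GF m) (α β : GF m) :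
    walshF F α β = ∑ x, chi (α * F x) * chi (β * x) :=
  sum_congr rfl fun x _ => by rw [neg_one_pow_val_add]; rfl

variable (F : GF m → GF m)

lemma walshF_zero_left (hm : m ≠ 0) (β : GF m) :
    walshF F 0 β = if β = 0 then 2 ^ m else 0 := by
  simp [walshF_eq_sum_chi, chi_zero, ← sum_chi_mul hm, mul_comm β]

lemma walshF_zero_right (hm : m ≠ 0) (hF : Function.Bijective F) {α : GF m} (hα : α ≠ 0) :
    walshF F α 0 = 0 := by
  simp only [walshF_eq_sum_chi, zero_mul, chi_zero, mul_one]
  rw [hF.sum_comp fun z => chi (α * z)]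
  simpa [hα, mul_comm] using sum_chi_mul hm α

lemma sum_walshF_mul_chi (hm : m ≠ 0) (α t : GF m) :
    ∑ a, walshF F α a * chi (a * t) = 2 ^ m * chi (α * F t) := by
  simp only [walshF_eq_sum_chi, sum_mul]
  rw [sum_comm]
  have (x : GF m) : ∑ a, chi (α * F x) * chi (a * x) * chi (a * t)
      = if x = t then 2 ^ m * chi (α * F t) else 0 := by
    have (a : GF m) : chi (α * F x) * chi (a * x) * chi (a * t)
        = chi (α * F x) * chi (a * (x + t)) := by rw [mul_add, chi_add, mul_assoc]
    simp only [this, ← mul_sum, sum_chi_mul hm, CharTwo.add_eq_zero]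
    split_ifs with h
    · rw [h, mul_comm]
    · simp
  simp [this]

lemma sum_walshF (hm : m ≠ 0) (hF : F 0 = 0) (α : GF m) : ∑ a, walshF F α a = 2 ^ m := by
  simpa [chi_zero, hF] using sum_walshF_mul_chi F hm α 0

lemma sum_walshF_mul_walshF (hm : m ≠ 0) (α β : GF m) :
    ∑ a, walshF F α a * walshF F β a = 2 ^ m * walshF F (α + β) 0 := by
  simp only [walshF_eq_sum_chi F β, walshF_eq_sum_chi F (α + β), mul_sum]
  rw [sum_comm]
  refine sum_congr rfl fun x _ => ?_
  have h := congrArg (chi (β * F x) * ·) (sum_walshF_mul_chi F hm α x)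
  simp only [mul_sum] at h
  rw [zero_mul, chi_zero, add_mul, chi_add]
  calc _ = _ := sum_congr rfl fun a _ => by ring
    _ = _ := h
    _ = _ := by ring

end Walsh

section Gold

variable {m i : ℕ}

lemma eq_zero_or_one_of_pow_two_pow_eq_self (hm : Odd m) (hi : Nat.gcd i m = 1) {x : GF m}
    (hx : x ^ 2 ^ (2 * i) = x) : x = 0 ∨ x = 1 := by
  have key (j : ℕ) : (frobenius (GF m) 2)^[j] x = x ^ 2 ^ j := by
    rw [← coe_iterateFrobenius, iterateFrobenius_def]
  have h1 : Function.IsPeriodicPt (frobenius (GF m) 2) (2 * i) x := (key _).trans hx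
  have h2 : Function.IsPeriodicPt (frobenius (GF m) 2) m x :=
    (key _).trans (pow_two_pow_self hm.pos.ne' x)
  have hg : (2 * i).gcd m = 1 := Nat.Coprime.mul_left hm.coprime_two_left hi
  have h := h1.gcd h2
  rw [hg] at h
  have h : x ^ 2 ^ 1 = x := (key 1).symm.trans h
  have : x * (x - 1) = 0 := by rw [mul_sub, mul_one, sub_eq_zero]; simpa [sq] using h
  simpa [sub_eq_zero] using this

lemma gold_bijective (hm : Odd m) (hi : Nat.gcd i m = 1) :
    Function.Bijective fun x : GF m => x ^ (2 ^ i + 1) := by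
  refine Finite.injective_iff_bijective.mp fun x y hxy => ?_
  replace hxy : x ^ (2 ^ i + 1) = y ^ (2 ^ i + 1) := hxy
  rcases eq_or_ne y 0 with rfl | hy
  · simpa using hxy
  have h1 : (x / y) ^ (2 ^ i + 1) = 1 := by rw [div_pow, hxy, div_self (pow_ne_zero _ hy)]
  have hx : x / y ≠ 0 := by
    intro h
    simp [h] at h1
  have h2 : (x / y) ^ 2 ^ (2 * i) = x / y := by
    obtain ⟨c, hc⟩ : ∃ c, 2 ^ i = c + 1 := ⟨2 ^ i - 1, by have := Nat.one_le_two_pow (n := i); omega⟩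
    have : 2 ^ (2 * i) = (2 ^ i + 1) * c + 1 := by rw [two_mul, pow_add, hc]; ring
    rw [this, pow_succ, pow_mul, h1, one_pow, one_mul]
  exact eq_of_div_eq_one ((eq_zero_or_one_of_pow_two_pow_eq_self hm hi h2).resolve_left hx)

lemma sum_chi_pow_two_pow_mul (hm : m ≠ 0) (i : ℕ) (a : GF m) :
    ∑ x : GF m, chi (x ^ 2 ^ i * a) = if a = 0 then 2 ^ m else 0 := by
  have hb : Function.Bijective (iterateFrobenius (GF m) 2 i) :=
    Finite.injective_iff_bijective.mp (iterateFrobenius_inj _ _ _)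
  rw [← sum_chi_mul hm, ← hb.sum_comp fun x => chi (x * a)]
  simp only [iterateFrobenius_def]

lemma gold_walshF_one_sq (hm : Odd m) (hi : Nat.gcd i m = 1) (a : GF m) :
    walshF (fun x : GF m => x ^ (2 ^ i + 1)) 1 a ^ 2 = 2 ^ m * (1 - chi a) := by
  have hm0 : m ≠ 0 := hm.pos.ne'
  have hterm (x u : GF m) :
      chi (x ^ (2 ^ i + 1)) * chi (a * x) * (chi ((x + u) ^ (2 ^ i + 1)) * chi (a * (x + u)))
        = chi (u ^ (2 ^ i + 1) + a * u) * chi (x ^ 2 ^ i * (u + u ^ 2 ^ (2 * i))) := by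
    have e1 : chi (x ^ 2 ^ i * (u + u ^ 2 ^ (2 * i))) = chi (x ^ 2 ^ i * u + x * u ^ 2 ^ i) := by
      rw [mul_add, chi_add, chi_add, ← chi_pow_two_pow i (x * u ^ 2 ^ i), mul_pow, ← pow_mul,
        ← pow_add, ← two_mul]
    rw [e1]
    simp only [← chi_add]
    congr 1
    rw [pow_succ (x + u), add_pow_char_pow x u 2 i]
    linear_combination (x ^ (2 ^ i + 1) + a * x) * CharTwo.two_eq_zero (R := GF m)
  simp only [walshF_eq_sum_chi, one_mul]
  rw [sq, sum_mul_sum]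
  calc _ = ∑ x : GF m, ∑ u : GF m,
        chi (u ^ (2 ^ i + 1) + a * u) * chi (x ^ 2 ^ i * (u + u ^ 2 ^ (2 * i))) := by
        refine sum_congr rfl fun x _ => ?_
        rw [← (Equiv.addLeft x).bijective.sum_comp]
        exact sum_congr rfl fun u _ => hterm x u
    _ = ∑ u : GF m, if u = 0 ∨ u = 1 then chi (u ^ (2 ^ i + 1) + a * u) * 2 ^ m else 0 := by
        rw [sum_comm]
        refine sum_congr rfl fun u _ => ?_
        rw [← mul_sum, sum_chi_pow_two_pow_mul hm0, CharTwo.add_eq_zero, mul_ite, mul_zero]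
        refine if_congr ⟨fun h => eq_zero_or_one_of_pow_two_pow_eq_self hm hi h.symm, ?_⟩ rfl rfl
        rintro (rfl | rfl) <;> simp
    _ = _ := by
        rw [← sum_filter]
        have : (univ.filter fun u : GF m => u = 0 ∨ u = 1) = {0, 1} := by ext; simp
        rw [this, sum_pair zero_ne_one]
        simp [chi_zero, chi_add, chi_one hm]
        ring

lemma gold_walshF_sq (hm : Odd m) (hi : Nat.gcd i m = 1) {ρ s : GF m} (hρ : ρ ≠ 0)
    (hs : s ^ (2 ^ i + 1) = ρ⁻¹) (a : GF m) :
    walshF (fun x : GF m => x ^ (2 ^ i + 1)) ρ a ^ 2 = 2 ^ m * (1 - chi (a * s)) := by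
  have hs0 : s ≠ 0 := by
    rintro rfl
    exact inv_ne_zero hρ (by rw [← hs]; simp)
  rw [← gold_walshF_one_sq hm hi]
  congr 1
  simp only [walshF_eq_sum_chi]
  rw [← (Equiv.mulLeft₀ s hs0).bijective.sum_comp]
  refine sum_congr rfl fun x _ => ?_
  have hx : Equiv.mulLeft₀ s hs0 x = s * x := rfl
  rw [hx, mul_pow, hs, mul_inv_cancel_left₀ hρ, one_mul, mul_assoc]

end Gold

section Moments

variable {m : ℕ} {F : GF m → GF m}

lemma sum_walshF_sq (hm : m ≠ 0) (α : GF m) :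
    ∑ a, walshF F α a ^ 2 = (2 ^ m) ^ 2 := by
  simp only [sq, sum_walshF_mul_walshF F hm, CharTwo.add_self_eq_zero, walshF_zero_left F hm,
    if_true]

lemma sum_walshF_sq_mul_walshF (hm : m ≠ 0) (hF0 : F 0 = 0) {α s : GF m} (hs : F s = α⁻¹)
    (hsq : ∀ a, walshF F α a ^ 2 = 2 ^ m * (1 - chi (a * s))) (β : GF m) :
    ∑ a, walshF F α a ^ 2 * walshF F β a = (2 ^ m) ^ 2 * (1 - chi (β * α⁻¹)) := by
  calc _ = 2 ^ m * ∑ a, walshF F β a - 2 ^ m * ∑ a, walshF F β a * chi (a * s) := by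
        rw [mul_sum, mul_sum, ← sum_sub_distrib]
        exact sum_congr rfl fun a _ => by rw [hsq]; ring
    _ = _ := by rw [sum_walshF F hm hF0, sum_walshF_mul_chi F hm, hs]; ring

lemma sum_walshF_sq_mul_walshF_sq (hm : m ≠ 0) {α β s t : GF m} (hs : s ≠ 0) (ht : t ≠ 0)
    (hst : s ≠ t) (hsq : ∀ a, walshF F α a ^ 2 = 2 ^ m * (1 - chi (a * s)))
    (htq : ∀ a, walshF F β a ^ 2 = 2 ^ m * (1 - chi (a * t))) :
    ∑ a, walshF F α a ^ 2 * walshF F β a ^ 2 = (2 ^ m) ^ 3 := by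
  have key (a : GF m) : walshF F α a ^ 2 * walshF F β a ^ 2
      = (2 ^ m) ^ 2 * (1 - chi (a * s) - chi (a * t) + chi (a * (s + t))) := by
    rw [mul_add a s t, chi_add, hsq, htq]; ring
  simp only [key, ← mul_sum, sum_add_distrib, sum_sub_distrib, sum_chi_mul hm, hs, ht,
    CharTwo.add_eq_zero, hst, if_false, sum_const, card_univ, card_GF hm]
  simp
  ring

/-- The deviation `4 w - 2 ^ m` of the weight `w` of `c_{x,y}`, except at `(x, y) = (0, 0)`,
where it is `0`. -/
def weightDev (F : GF m → GF m) (nu x y : GF m) : ℤ :=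
  walshF F (y + nu) x - if y = 0 then 0 else walshF F y x

/-- The properties of Gold almost bent functions that determine the power moments. -/
structure GoldLike (F : GF m → GF m) : Prop where
  odd : Odd m
  map_zero : F 0 = 0
  bijective : Function.Bijective F
  walshF_sq : ∀ ρ s : GF m, ρ ≠ 0 → F s = ρ⁻¹ → ∀ a,
    walshF F ρ a ^ 2 = 2 ^ m * (1 - chi (a * s))
  walshF_cube : ∀ ρ a : GF m, ρ ≠ 0 → walshF F ρ a ^ 3 = 2 * 2 ^ m * walshF F ρ a

namespace GoldLike

variable (h : GoldLike F) {nu : GF m} (hnu : nu ≠ 0)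

include h

lemma ne_zero : m ≠ 0 := h.odd.pos.ne'

lemma chi_div_add {y nu : GF m} (hy : y + nu ≠ 0) :
    chi (y * (y + nu)⁻¹) = -chi (nu * (y + nu)⁻¹) := by
  have : y * (y + nu)⁻¹ = 1 + nu * (y + nu)⁻¹ := by
    field_simp
    rw [add_assoc, CharTwo.add_self_eq_zero, add_zero]
  rw [this, chi_add, chi_one h.odd, neg_one_mul]

include hnu

lemma moments_at_zero :
    ∑ x, weightDev F nu x 0 = 2 ^ m ∧ ∑ x, weightDev F nu x 0 ^ 2 = (2 ^ m) ^ 2 ∧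
    ∑ x, weightDev F nu x 0 ^ 3 = 2 * (2 ^ m) ^ 2 ∧
    ∑ x, weightDev F nu x 0 ^ 4 = 2 * (2 ^ m) ^ 3 := by
  simp only [weightDev, zero_add, if_true, sub_zero]
  refine ⟨sum_walshF F h.ne_zero h.map_zero _, sum_walshF_sq h.ne_zero _, ?_, ?_⟩
  · simp only [h.walshF_cube nu _ hnu, ← mul_sum, sum_walshF F h.ne_zero h.map_zero]
    ring
  · have (x : GF m) : walshF F nu x ^ 4 = 2 * 2 ^ m * walshF F nu x ^ 2 := by
      rw [pow_succ, h.walshF_cube nu _ hnu]; ring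
    simp only [this, ← mul_sum, sum_walshF_sq h.ne_zero]
    ring

lemma moments_of_ne {y : GF m} (hy : y ≠ 0) (hy' : y + nu ≠ 0) :
    ∑ x, weightDev F nu x y = 0 ∧ ∑ x, weightDev F nu x y ^ 2 = 2 * (2 ^ m) ^ 2 ∧
    ∑ x, weightDev F nu x y ^ 3
      = 3 * (2 ^ m) ^ 2 * (chi (nu * y⁻¹) - chi (nu * (y + nu)⁻¹)) ∧
    ∑ x, weightDev F nu x y ^ 4 = 10 * (2 ^ m) ^ 3 := by
  obtain ⟨s, hs⟩ := h.bijective.2 (y + nu)⁻¹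
  obtain ⟨t, ht⟩ := h.bijective.2 y⁻¹
  have hs0 : s ≠ 0 := by rintro rfl; exact inv_ne_zero hy' (hs.symm.trans h.map_zero)
  have ht0 : t ≠ 0 := by rintro rfl; exact inv_ne_zero hy (ht.symm.trans h.map_zero)
  have hst : s ≠ t := by
    rintro rfl
    exact hnu (by simpa using inv_injective (hs.symm.trans ht))
  have hm := h.ne_zero
  have hA := h.walshF_sq _ s hy' hs
  have hB := h.walshF_sq _ t hy ht
  have A1 := sum_walshF F hm h.map_zero (y + nu)
  have B1 := sum_walshF F hm h.map_zero y
  have A2 := sum_walshF_sq (F := F) hm (y + nu)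
  have B2 := sum_walshF_sq (F := F) hm y
  have AB : ∑ a, walshF F (y + nu) a * walshF F y a = 0 := by
    rw [sum_walshF_mul_walshF F hm, add_right_comm, CharTwo.add_self_eq_zero, zero_add,
      walshF_zero_right F hm h.bijective hnu, mul_zero]
  have AAB := sum_walshF_sq_mul_walshF hm h.map_zero hs hA y
  have ABB := sum_walshF_sq_mul_walshF hm h.map_zero ht hB (y + nu)
  have AABB := sum_walshF_sq_mul_walshF_sq hm hs0 ht0 hst hA hB
  rw [h.chi_div_add hy'] at AAB
  have e : chi ((y + nu) * y⁻¹) = -chi (nu * y⁻¹) := by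
    rw [add_mul, mul_inv_cancel₀ hy, chi_add, chi_one h.odd, neg_one_mul]
  rw [e] at ABB
  simp only [weightDev, hy, if_false]
  have cA := fun a => h.walshF_cube (y + nu) a hy'
  have cB := fun a => h.walshF_cube y a hy
  generalize walshF F (y + nu) = A at *
  generalize walshF F y = B at *
  refine ⟨?_, ?_, ?_, ?_⟩
  · rw [sum_sub_distrib, A1, B1, sub_self]
  · calc _ = ∑ a, A a ^ 2 - 2 * ∑ a, A a * B a + ∑ a, B a ^ 2 := by
          rw [mul_sum, ← sum_sub_distrib, ← sum_add_distrib]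
          exact sum_congr rfl fun a _ => by ring
      _ = _ := by rw [A2, B2, AB]; ring
  · calc _ = 2 * 2 ^ m * ∑ a, A a - 2 * 2 ^ m * ∑ a, B a - 3 * ∑ a, A a ^ 2 * B a
            + 3 * ∑ a, B a ^ 2 * A a := by
          simp only [mul_sum]
          rw [← sum_sub_distrib, ← sum_sub_distrib, ← sum_add_distrib]
          exact sum_congr rfl fun a _ => by linear_combination cA a - cB a
      _ = _ := by rw [A1, B1, AAB, ABB]; ring
  · calc _ = 2 * 2 ^ m * ∑ a, A a ^ 2 + 2 * 2 ^ m * ∑ a, B a ^ 2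
            - 16 * 2 ^ m * ∑ a, A a * B a + 6 * ∑ a, A a ^ 2 * B a ^ 2 := by
          simp only [mul_sum]
          rw [← sum_add_distrib, ← sum_sub_distrib, ← sum_add_distrib]
          exact sum_congr rfl fun a _ => by
            linear_combination (A a - 4 * B a) * cA a + (B a - 4 * A a) * cB a
      _ = _ := by rw [A2, B2, AB, AABB]; ring

end GoldLike

variable {nu : GF m}

lemma two_mul_sum_trace_zero (hnu : nu ≠ 0) (g : GF m → ℤ) :
    2 * ∑ y with tr (nu⁻¹ * y) = 0, g y = ∑ z, (1 + chi z) * g (nu * z) := by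
  rw [sum_filter, ← (Equiv.mulLeft₀ nu hnu).bijective.sum_comp, mul_sum]
  refine sum_congr rfl fun z _ => ?_
  have hz : Equiv.mulLeft₀ nu hnu z = nu * z := rfl
  rw [hz, inv_mul_cancel_left₀ hnu]
  rcases tr_eq_zero_or_one z with h | h
  · rw [if_pos h, chi_of_tr_eq_zero h]; ring
  · rw [if_neg (by rw [h]; decide), chi_of_tr_eq_one h]; ring

lemma two_mul_card_trace_zero (hm : m ≠ 0) (hnu : nu ≠ 0) :
    2 * ((univ.filter fun y : GF m => tr (nu⁻¹ * y) = 0).card : ℤ) = 2 ^ m := by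
  simpa [sum_add_distrib, sum_chi hm, card_GF hm] using two_mul_sum_trace_zero hnu fun _ => 1

lemma sum_chi_inv (hm : m ≠ 0) : ∑ z : GF m, chi z⁻¹ = 0 := by
  rw [← sum_chi hm]
  exact inv_involutive.bijective.sum_comp chi

lemma sum_trace_zero_chi_inv_sub (hm : Odd m) (hnu : nu ≠ 0) :
    ∑ y with tr (nu⁻¹ * y) = 0, (chi (nu * y⁻¹) - chi (nu * (y + nu)⁻¹))
      = ∑ z : GF m, chi (z⁻¹ + z) := by
  have hm0 := hm.pos.ne'
  have key := two_mul_sum_trace_zero hnu fun y => chi (nu * y⁻¹) - chi (nu * (y + nu)⁻¹)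
  have e (z : GF m) : (1 + chi z) * (chi (nu * (nu * z)⁻¹) - chi (nu * (nu * z + nu)⁻¹))
      = chi z⁻¹ + chi (z⁻¹ + z) - chi (z + 1)⁻¹ + chi ((z + 1)⁻¹ + (z + 1)) := by
    have : nu * z + nu = nu * (z + 1) := by ring
    rw [this, mul_inv, mul_inv, mul_inv_cancel_left₀ hnu, mul_inv_cancel_left₀ hnu]
    simp only [chi_add, chi_one hm]
    ring
  have hb : Function.Bijective fun z : GF m => z + 1 := (Equiv.addRight 1).bijective
  simp only [e, sum_add_distrib, sum_sub_distrib, sum_chi_inv hm0,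
    hb.sum_comp fun z => chi z⁻¹, hb.sum_comp fun z => chi (z⁻¹ + z)] at key
  rw [sum_sub_distrib]
  linarith

namespace GoldLike

variable (h : GoldLike F) (hnu : nu ≠ 0)
include h hnu

lemma sum_trace_zero_eq {f g : GF m → ℤ} (hfg : ∀ y, y ≠ 0 → y + nu ≠ 0 → f y = g y) :
    ∑ y with tr (nu⁻¹ * y) = 0, f y
      = f 0 - g 0 + ∑ y with tr (nu⁻¹ * y) = 0, g y := by
  have h0 : (0 : GF m) ∈ univ.filter fun y : GF m => tr (nu⁻¹ * y) = 0 := by simp [tr_zero]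
  rw [← add_sum_erase _ f h0, ← add_sum_erase _ g h0, sum_congr rfl fun y hy => hfg y ?_ ?_]
  · ring
  · exact ne_of_mem_erase hy
  · intro hc
    have hy := (mem_filter.mp (mem_of_mem_erase hy)).2
    rw [CharTwo.add_eq_zero.mp hc, inv_mul_cancel₀ hnu, tr_one h.odd] at hy
    exact one_ne_zero hy

lemma moments :
    ∑ p : GF m × GF m with tr (nu⁻¹ * p.2) = 0, weightDev F nu p.1 p.2 = 2 ^ m ∧
    ∑ p : GF m × GF m with tr (nu⁻¹ * p.2) = 0, weightDev F nu p.1 p.2 ^ 2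
      = (2 ^ m) ^ 3 - (2 ^ m) ^ 2 ∧
    ∑ p : GF m × GF m with tr (nu⁻¹ * p.2) = 0, weightDev F nu p.1 p.2 ^ 3
      = (2 ^ m) ^ 2 * (3 * ∑ z : GF m, chi (z⁻¹ + z) - 4) ∧
    ∑ p : GF m × GF m with tr (nu⁻¹ * p.2) = 0, weightDev F nu p.1 p.2 ^ 4
      = 5 * (2 ^ m) ^ 4 - 8 * (2 ^ m) ^ 3 := by
  have split (f : GF m → GF m → ℤ) : ∑ p : GF m × GF m with tr (nu⁻¹ * p.2) = 0, f p.1 p.2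
      = ∑ y with tr (nu⁻¹ * y) = 0, ∑ x, f x y := by
    simp only [sum_filter, Fintype.sum_prod_type_right]
    refine sum_congr rfl fun y _ => ?_
    split_ifs <;> simp
  have h3 := congrArg (3 * (2 ^ m) ^ 2 * ·) (sum_trace_zero_chi_inv_sub h.odd hnu)
  simp only [mul_sum (a := 3 * (2 ^ m) ^ 2) (f := fun y => chi (nu * y⁻¹) - chi (nu * (y + nu)⁻¹))]
    at h3
  have hc := two_mul_card_trace_zero h.ne_zero hnu
  obtain ⟨z1, z2, z3, z4⟩ := h.moments_at_zero hnu
  rw [split fun x y => weightDev F nu x y, split fun x y => weightDev F nu x y ^ 2,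
    split fun x y => weightDev F nu x y ^ 3, split fun x y => weightDev F nu x y ^ 4,
    h.sum_trace_zero_eq hnu fun y hy hy' => (h.moments_of_ne hnu hy hy').1,
    h.sum_trace_zero_eq hnu fun y hy hy' => (h.moments_of_ne hnu hy hy').2.1,
    h.sum_trace_zero_eq hnu fun y hy hy' => (h.moments_of_ne hnu hy hy').2.2.1,
    h.sum_trace_zero_eq hnu fun y hy hy' => (h.moments_of_ne hnu hy hy').2.2.2,
    z1, z2, z3, z4, h3]
  simp only [sum_const, nsmul_eq_mul, inv_zero, mul_zero, zero_add, mul_inv_cancel₀ hnu, chi_zero,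
    chi_one h.odd]
  refine ⟨by ring, ?_, by ring, ?_⟩
  · linear_combination (2 ^ m) ^ 2 * hc
  · linear_combination 5 * (2 ^ m) ^ 3 * hc

end GoldLike

end Moments

section Counting

lemma counts_of_moments {α : Type*} (S : Finset α) (v : α → ℤ) {T : ℤ} (hT : T ≠ 0)
    (hv : ∀ p ∈ S, v p = 0 ∨ v p = T ∨ v p = -T ∨ v p = 2 * T ∨ v p = -(2 * T)) :
    24 * T ^ 4 * (#{p ∈ S | v p = -(2 * T)} : ℤ)
      = ∑ p ∈ S, v p ^ 4 - 2 * T * ∑ p ∈ S, v p ^ 3 - T ^ 2 * ∑ p ∈ S, v p ^ 2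
        + 2 * T ^ 3 * ∑ p ∈ S, v p ∧
    6 * T ^ 4 * (#{p ∈ S | v p = -T} : ℤ)
      = -∑ p ∈ S, v p ^ 4 + T * ∑ p ∈ S, v p ^ 3 + 4 * T ^ 2 * ∑ p ∈ S, v p ^ 2
        - 4 * T ^ 3 * ∑ p ∈ S, v p ∧
    4 * T ^ 4 * (#{p ∈ S | v p = 0} : ℤ)
      = ∑ p ∈ S, v p ^ 4 - 5 * T ^ 2 * ∑ p ∈ S, v p ^ 2 + 4 * T ^ 4 * #S ∧
    6 * T ^ 4 * (#{p ∈ S | v p = T} : ℤ)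
      = -∑ p ∈ S, v p ^ 4 - T * ∑ p ∈ S, v p ^ 3 + 4 * T ^ 2 * ∑ p ∈ S, v p ^ 2
        + 4 * T ^ 3 * ∑ p ∈ S, v p ∧
    24 * T ^ 4 * (#{p ∈ S | v p = 2 * T} : ℤ)
      = ∑ p ∈ S, v p ^ 4 + 2 * T * ∑ p ∈ S, v p ^ 3 - T ^ 2 * ∑ p ∈ S, v p ^ 2
        - 2 * T ^ 3 * ∑ p ∈ S, v p := by
  simp only [card_eq_sum_ones, sum_filter, Nat.cast_sum, mul_sum, ← sum_neg_distrib,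
    ← sum_add_distrib, ← sum_sub_distrib]
  refine ⟨?_, ?_, ?_, ?_, ?_⟩ <;> refine sum_congr rfl fun p hp => ?_ <;>
    rcases hv p hp with e | e | e | e | e <;> rw [e] <;> split_ifs <;>
    first | (exfalso; omega) | (push_cast; ring)

end Counting

section Weight

variable {m : ℕ} (F : GF m → GF m) (nu x y : GF m)

lemma one_sub_chi (z : GF m) : 1 - chi z = if tr z = 1 then 2 else 0 := by
  rcases tr_eq_zero_or_one z with h | h
  · rw [chi_of_tr_eq_zero h, if_neg (by rw [h]; decide), sub_self]
  · rw [chi_of_tr_eq_one h, if_pos h]; rfl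

lemma four_mul_wtc (hm : m ≠ 0) : 4 * (wtc F nu x y : ℤ)
    = 2 ^ m - walshF F nu 0 - walshF F y x + walshF F (y + nu) x := by
  have hw : (wtc F nu x y : ℤ)
      = ∑ d : GF m, if tr (nu * F d) = 1 then if tr (x * d + y * F d) = 1 then 1 else 0 else 0 := by
    rw [wtc, card_eq_sum_ones, sum_filter, Nat.cast_sum, ← sum_filter,
      sum_subtype (p := fun d : GF m => tr (nu * F d) = 1) _ (by simp)]
    refine sum_congr rfl fun d _ => ?_
    have hne (a : ZMod 2) : a ≠ 0 ↔ a = 1 := by revert a; decide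
    simp only [cw, ← tr_add, hne]
    split_ifs <;> rfl
  rw [hw, mul_sum]
  calc _ = ∑ d : GF m, (1 - chi (nu * F d)) * (1 - chi (x * d + y * F d)) := by
        refine sum_congr rfl fun d _ => ?_
        rw [one_sub_chi, one_sub_chi]
        split_ifs <;> rfl
    _ = ∑ d : GF m, (1 - chi (nu * F d) * chi (0 * d) - chi (y * F d) * chi (x * d)
          + chi ((y + nu) * F d) * chi (x * d)) := by
        refine sum_congr rfl fun d _ => ?_
        rw [add_mul, chi_add, chi_add, zero_mul, chi_zero]
        ring
    _ = _ := by
        simp only [sum_add_distrib, sum_sub_distrib, walshF_eq_sum_chi, sum_const, card_univ,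
          card_GF hm]
        simp

end Weight

section WeightDeviation

variable {m : ℕ} {F : GF m → GF m} {nu : GF m}

lemma wtc_zero_zero (F : GF m → GF m) (nu : GF m) : wtc F nu 0 0 = 0 := by
  simp [wtc, cw, tr_zero]

lemma GoldLike.weightDev_zero_zero (h : GoldLike F) (hnu : nu ≠ 0) : weightDev F nu 0 0 = 0 := by
  simp [weightDev, walshF_zero_right F h.ne_zero h.bijective hnu]

lemma GoldLike.four_mul_wtc (h : GoldLike F) (hnu : nu ≠ 0) {x y : GF m} (hxy : ¬(x = 0 ∧ y = 0)) :
    4 * (wtc F nu x y : ℤ) = 2 ^ m + weightDev F nu x y := by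
  rw [_root_.four_mul_wtc F nu x y h.ne_zero, walshF_zero_right F h.ne_zero h.bijective hnu,
    weightDev]
  split_ifs with hy
  · subst hy
    rw [walshF_zero_left F h.ne_zero, if_neg fun hx => hxy ⟨hx, rfl⟩]
    ring
  · ring

lemma gold_goldLike {k i : ℕ} (hm : m = 2 * k + 1) (hi : Nat.gcd i m = 1)
    (hAB : ∀ ρ : GF m, ρ ≠ 0 → ∀ a : GF m, walshF (fun x : GF m => x ^ (2 ^ i + 1)) ρ a ∈
      ({0, 2 ^ (k + 1), -(2 ^ (k + 1))} : Set ℤ)) :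
    GoldLike fun x : GF m => x ^ (2 ^ i + 1) where
  odd := ⟨k, hm⟩
  map_zero := by simp
  bijective := gold_bijective ⟨k, hm⟩ hi
  walshF_sq _ _ hρ hs a := gold_walshF_sq ⟨k, hm⟩ hi hρ hs a
  walshF_cube ρ a hρ := by
    have hT : 2 * 2 ^ m = ((2 : ℤ) ^ (k + 1)) ^ 2 := by rw [hm]; ring
    rw [hT]
    rcases hAB ρ hρ a with e | e | e <;> rw [e] <;> ring

lemma weightDev_mem_of_tr_eq_zero (hm : Odd m) (hnu : nu ≠ 0) {T : ℤ}
    (hAB : ∀ ρ : GF m, ρ ≠ 0 → ∀ a : GF m, walshF F ρ a ∈ ({0, T, -T} : Set ℤ))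
    (x : GF m) {y : GF m} (hy : tr (nu⁻¹ * y) = 0) :
    weightDev F nu x y = 0 ∨ weightDev F nu x y = T ∨ weightDev F nu x y = -T ∨
      weightDev F nu x y = 2 * T ∨ weightDev F nu x y = -(2 * T) := by
  have hy' : y + nu ≠ 0 := by
    intro hc
    rw [CharTwo.add_eq_zero.mp hc, inv_mul_cancel₀ hnu, tr_one hm] at hy
    exact one_ne_zero hy
  have hA := hAB _ hy' x
  simp only [Set.mem_insert_iff, Set.mem_singleton_iff] at hA
  rw [weightDev]
  split_ifs with h0
  · omega
  · have hB := hAB _ h0 x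
    simp only [Set.mem_insert_iff, Set.mem_singleton_iff] at hB
    omega

lemma cw_sub (F : GF m → GF m) (nu x x' y y' : GF m) :
    cw F nu (x - x') (y - y') = cw F nu x y - cw F nu x' y' := by
  funext d
  have h (a b : GF m) : tr (a - b) = tr a - tr b := map_sub (Algebra.trace _ _) a b
  simp only [cw, sub_mul, h, Pi.sub_apply]
  ring

lemma wtc_eq_zero_iff (F : GF m → GF m) (nu x y : GF m) : wtc F nu x y = 0 ↔ cw F nu x y = 0 := by
  simp [wtc, filter_eq_empty_iff, funext_iff]

end WeightDeviation

/-- the weight distribution of the subcode `C_{D_{f_ν},H_ν}` for a Gold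
almost bent function `F(x) = x^e`, `e = 2^i+1`, on `GF(2^m)`, `m = 2k+1 ≥ 5` odd, where
`H_ν = {y : Tr(ν⁻¹·y) = 0}` and `K1` is the Kloosterman sum at `1`. -/
theorem stmt16 (m k i : ℕ) (hm : m = 2 * k + 1) (hm5 : 5 ≤ m)
    (hi : Nat.gcd i m = 1) (hi1 : 1 ≤ i) (hik : i ≤ k)
    (e : ℕ) (he : e = 2 ^ i + 1)
    (F : GF m → GF m) (hF : ∀ x : GF m, F x = x ^ e)
    (hAB : ∀ ρ : GF m, ρ ≠ 0 → ∀ a : GF m,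
      walshF F ρ a ∈ ({0, 2 ^ (k + 1), -(2 ^ (k + 1))} : Set ℤ))
    (nu : GF m) (hnu : nu ≠ 0)
    (K1 : ℤ) (hK : K1 = ∑ x : GF m, (-1 : ℤ) ^ (tr (x⁻¹ + x)).val) :
    Function.Injective
      (fun p : GF m × {y : GF m // tr (nu⁻¹ * y) = 0} => cw F nu p.1 p.2.1) ∧
    Nat.card {c : Dsupp F nu → ZMod 2 |
      ∃ x y : GF m, tr (nu⁻¹ * y) = 0 ∧ c = cw F nu x y} = 2 ^ (2 * m - 1) ∧
    (∀ x : GF m, ∀ y : GF m, tr (nu⁻¹ * y) = 0 → wtc F nu x y ∈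
      ({0, 2 ^ (m - 2) - 2 ^ k, 2 ^ (m - 2) - 2 ^ (k - 1), 2 ^ (m - 2),
        2 ^ (m - 2) + 2 ^ (k - 1), 2 ^ (m - 2) + 2 ^ k} : Set ℕ)) ∧
    AwHs F nu 0 = 1 ∧
    (AwHs F nu (2 ^ (m - 2) - 2 ^ k) : ℚ)
      = (2:ℚ)^(4*k)/8 + (2:ℚ)^k/4 - (2:ℚ)^k/8 * K1 - (2:ℚ)^(2*k)/8 ∧
    (AwHs F nu (2 ^ (m - 2) - 2 ^ (k - 1)) : ℚ)
      = (2:ℚ)^(4*k)/2 + (2:ℚ)^k/4 * K1 - (2:ℚ)^k ∧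
    (AwHs F nu (2 ^ (m - 2)) : ℚ)
      = 3 * (2:ℚ)^(4*k)/4 + (2:ℚ)^(2*k)/4 - 1 ∧
    (AwHs F nu (2 ^ (m - 2) + 2 ^ (k - 1)) : ℚ)
      = (2:ℚ)^(4*k)/2 - (2:ℚ)^k/4 * K1 + (2:ℚ)^k ∧
    (AwHs F nu (2 ^ (m - 2) + 2 ^ k) : ℚ)
      = (2:ℚ)^(4*k)/8 - (2:ℚ)^k/4 + (2:ℚ)^k/8 * K1 - (2:ℚ)^(2*k)/8 := by
  obtain rfl : F = fun x => x ^ (2 ^ i + 1) := by funext x; rw [hF, he]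
  have hodd : Odd m := ⟨k, hm⟩
  have h := gold_goldLike hm hi hAB
  generalize (fun x : GF m => x ^ (2 ^ i + 1)) = F at *
  obtain ⟨j, rfl⟩ : ∃ j, k = j + 1 := ⟨k - 1, by omega⟩
  have hj : 1 ≤ j := by omega
  obtain ⟨P, hP⟩ : ∃ P : ℕ, P = 2 ^ j := ⟨_, rfl⟩
  have hP2 : 2 ≤ P := hP ▸ Nat.pow_le_pow_right two_pos hj
  have hPP : 2 * P ≤ P ^ 2 := by nlinarith
  have hq : (2 : ℤ) ^ m = 8 * (P : ℤ) ^ 2 := by rw [hP, hm]; push_cast; ring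
  have hT : (2 : ℤ) ^ (j + 1 + 1) = 4 * P := by rw [hP]; push_cast; ring
  have hm2 : 2 ^ (m - 2) = 2 * P ^ 2 := by
    rw [hP, hm, show 2 * (j + 1) + 1 - 2 = 2 * j + 1 by omega]; ring
  have hk1 : 2 ^ (j + 1) = 2 * P := by rw [hP]; ring
  rw [hT] at hAB
  have hV (x y : GF m) (hy : tr (nu⁻¹ * y) = 0) := weightDev_mem_of_tr_eq_zero hodd hnu hAB x hy
  have hw (x y : GF m) (hxy : ¬(x = 0 ∧ y = 0)) := h.four_mul_wtc hnu hxy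
  have hV0 := h.weightDev_zero_zero hnu
  have hw0 := wtc_zero_zero F nu
  have hinj0 (x y : GF m) (hy : tr (nu⁻¹ * y) = 0) (h0 : wtc F nu x y = 0) : x = 0 ∧ y = 0 := by
    by_contra hxy
    have h1 := hw x y hxy
    have h2 := hV x y hy
    zify at hPP hP2
    rw [hq, h0] at h1
    omega
  have hinj : Function.Injective
      (fun p : GF m × {y : GF m // tr (nu⁻¹ * y) = 0} => cw F nu p.1 p.2.1) := by
    rintro ⟨x, y, hy⟩ ⟨x', y', hy'⟩ hp
    have hd : tr (nu⁻¹ * (y - y')) = 0 := by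
      rw [CharTwo.sub_eq_add, mul_add, tr_add, hy, hy', add_zero]
    obtain ⟨h1, h2⟩ := hinj0 (x - x') (y - y') hd <| by
      rw [wtc_eq_zero_iff, cw_sub, sub_eq_zero]
      exact hp
    simp [sub_eq_zero.mp h1, sub_eq_zero.mp h2]
  have hcH : 2 * (univ.filter fun y : GF m => tr (nu⁻¹ * y) = 0).card = 2 ^ m := by
    exact_mod_cast two_mul_card_trace_zero h.ne_zero hnu
  -- counting weights amounts to counting values of `weightDev`
  have hcount (w : ℕ) (c : ℤ) (hwc : 4 * (w : ℤ) - 2 ^ m = c) (hc : c ≠ 0) (hw' : w ≠ 0) :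
      AwHs F nu w = #{p ∈ univ.filter (fun p : GF m × GF m => tr (nu⁻¹ * p.2) = 0) |
        weightDev F nu p.1 p.2 = c} := by
    rw [AwHs, filter_filter]
    congr 1
    refine filter_congr fun p _ => and_congr_right fun hp => ?_
    by_cases hxy : p.1 = 0 ∧ p.2 = 0
    · rw [hxy.1, hxy.2, hw0, hV0]
      exact iff_of_false hw'.symm hc.symm
    · have := hw _ _ hxy
      omega
  have hcount0 : AwHs F nu (2 * P ^ 2) + 1 =
      #{p ∈ univ.filter (fun p : GF m × GF m => tr (nu⁻¹ * p.2) = 0) |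
        weightDev F nu p.1 p.2 = 0} := by
    rw [AwHs, filter_filter, ← card_insert_of_notMem (a := (0 : GF m × GF m))]
    · congr 1
      ext p
      simp only [mem_insert, mem_filter, mem_univ, true_and, Prod.ext_iff, Prod.fst_zero,
        Prod.snd_zero]
      by_cases hxy : p.1 = 0 ∧ p.2 = 0
      · simp [hxy.1, hxy.2, hV0, tr_zero]
      · have h1 := hw _ _ hxy
        rw [hq] at h1
        simp only [hxy, false_or]
        refine and_congr_right fun hp => ?_
        zify
        omega
    · have : P ≠ 0 := by omega
      simp [hw0, this]
  have hP0 : (P : ℤ) ≠ 0 := by omega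
  obtain ⟨M1, M2, M3, M4⟩ := h.moments hnu
  rw [show ∑ z : GF m, chi (z⁻¹ + z) = K1 from hK.symm] at M3
  obtain ⟨cm2, cm1, c0, c1, c2⟩ := counts_of_moments
    (univ.filter fun p : GF m × GF m => tr (nu⁻¹ * p.2) = 0)
    (fun p => weightDev F nu p.1 p.2) (T := 4 * P) (by omega)
    fun p hp => hV _ _ (mem_filter.mp hp).2
  have hcS : 2 * #(univ.filter fun p : GF m × GF m => tr (nu⁻¹ * p.2) = 0) = (2 ^ m) ^ 2 := by
    have : (univ.filter fun p : GF m × GF m => tr (nu⁻¹ * p.2) = 0)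
        = univ ×ˢ univ.filter fun y : GF m => tr (nu⁻¹ * y) = 0 := by ext; simp
    rw [this, card_product, card_univ, card_GF h.ne_zero]
    linear_combination 2 ^ m * hcH
  zify at hcS hcount0
  simp only [M1, M2, M3, M4, hq] at cm2 cm1 c0 c1 c2
  have hz2 : ((2 * P ^ 2 - 2 * P : ℕ) : ℤ) = 2 * P ^ 2 - 2 * P := by
    rw [Nat.cast_sub (by omega)]; push_cast; rfl
  have hz1 : ((2 * P ^ 2 - P : ℕ) : ℤ) = 2 * P ^ 2 - P := by
    rw [Nat.cast_sub (by omega)]; push_cast; rfl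
  have q4 : (2 : ℚ) ^ (4 * (j + 1)) = 16 * P ^ 4 := by rw [hP]; push_cast; ring
  have q2 : (2 : ℚ) ^ (2 * (j + 1)) = 4 * P ^ 2 := by rw [hP]; push_cast; ring
  have q1 : (2 : ℚ) ^ (j + 1) = 2 * P := by rw [hP]; push_cast; ring
  have hPQ : (P : ℚ) ≠ 0 := by exact_mod_cast hP0
  rw [Nat.add_sub_cancel, ← hP, hm2, hk1, q4, q2, q1]
  refine ⟨hinj, ?_, ?_, ?_, ?_, ?_, ?_, ?_, ?_⟩
  · have hset : {c : Dsupp F nu → ZMod 2 | ∃ x y : GF m, tr (nu⁻¹ * y) = 0 ∧ c = cw F nu x y}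
        = Set.range fun p : GF m × {y : GF m // tr (nu⁻¹ * y) = 0} => cw F nu p.1 p.2.1 := by
      ext c
      constructor
      · rintro ⟨x, y, hy, rfl⟩
        exact ⟨(x, ⟨y, hy⟩), rfl⟩
      · rintro ⟨⟨x, y, hy⟩, rfl⟩
        exact ⟨x, y, hy, rfl⟩
    rw [hset, Nat.card_range_of_injective hinj, Nat.card_prod, Nat.card_eq_fintype_card,
      Nat.card_eq_fintype_card, card_GF h.ne_zero, Fintype.card_subtype]
    refine Nat.eq_of_mul_eq_mul_left two_pos ?_
    rw [← pow_succ', show 2 * m - 1 + 1 = m + m by omega, pow_add]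
    linear_combination 2 ^ m * hcH
  · intro x y hy
    simp only [Set.mem_insert_iff, Set.mem_singleton_iff]
    by_cases hxy : x = 0 ∧ y = 0
    · rw [hxy.1, hxy.2]
      exact Or.inl hw0
    · have h1 := hw x y hxy
      have h2 := hV x y hy
      rw [hq] at h1
      zify [show 2 * P ≤ 2 * P ^ 2 by omega, show P ≤ 2 * P ^ 2 by omega]
      omega
  · rw [AwHs, card_eq_one]
    refine ⟨(0, 0), ?_⟩
    ext ⟨x, y⟩
    simp only [mem_filter, mem_univ, true_and, mem_singleton, Prod.mk.injEq]
    constructor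
    · rintro ⟨hy, hxy⟩
      exact hinj0 x y hy hxy
    · rintro ⟨rfl, rfl⟩
      exact ⟨by rw [mul_zero, tr_zero], hw0⟩
  · rw [← hcount (2 * P ^ 2 - 2 * P) _ (by rw [hz2, hq]; ring) (by omega) (by omega)] at cm2
    refine mul_left_cancel₀ (a := 24 * (4 * (P : ℚ)) ^ 4) (by positivity) ?_
    qify at cm2
    rw [cm2]
    ring
  · rw [← hcount (2 * P ^ 2 - P) _ (by rw [hz1, hq]; ring) (by omega) (by omega)] at cm1
    refine mul_left_cancel₀ (a := 6 * (4 * (P : ℚ)) ^ 4) (by positivity) ?_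
    qify at cm1
    rw [cm1]
    ring
  · refine mul_left_cancel₀ (a := 4 * (4 * (P : ℚ)) ^ 4) (by positivity) ?_
    rw [hq] at hcS
    rw [← hcount0] at c0
    qify at c0 hcS
    linear_combination c0 + 4 * (4 * (P : ℚ)) ^ 4 * hcS / 2
  · rw [← hcount (2 * P ^ 2 + P) _ (by rw [hq]; push_cast; ring) (by omega) (by omega)] at c1
    refine mul_left_cancel₀ (a := 6 * (4 * (P : ℚ)) ^ 4) (by positivity) ?_
    qify at c1
    rw [c1]
    ring
  · rw [← hcount (2 * P ^ 2 + 2 * P) _ (by rw [hq]; push_cast; ring) (by omega) (by omega)] at c2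
    refine mul_left_cancel₀ (a := 24 * (4 * (P : ℚ)) ^ 4) (by positivity) ?_
    qify at c2
    rw [c2]
    ring
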